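/- Let I and J be nonempty finite sets and let μ_i > 0 for each i ∈ I. Suppose continuous functions y_i, w_i : [0,∞) → ℝ (i ∈ I), z_j : [0,∞) → ℝ (j ∈ J) and ψ_ij : [0,∞) → ℝ satisfy, for all t ≥ 0: (𝔗_{μ_i}(∑_{j∈J} ψ_ij))(t) = w_i(t) − y_i(t) for each i ∈ I, and ∑_{i∈I} ψ_ij(t) = −z_j(t) for each j ∈ J. Then for all t ≥ 0: ∑_{i∈I} (𝔗_{M_i}(w_i − y_i))(t) + (𝔗_M(∑_{j∈J} z_j))(t) = 0, where 𝔗_{M_i} is the composition of the operators 𝔗_{μ_{i'}} over i' ∈ I with i' ≠ i, and 𝔗_M is the composition of 𝔗_{μ_{i'}} over all i' ∈ I (well defined in any order since these operators commute). -/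

import Mathlib

open MeasureTheory Set

/-- `(𝔍 f) t = ∫₀ᵗ f(s) ds`. -/
noncomputable def 𝔍 (f : ℝ → ℝ) (t : ℝ) : ℝ := ∫ s in (0:ℝ)..t, f s

/-- `(𝔗_α f)(t) = f(t) + α (𝔍 f)(t)`. -/
noncomputable def 𝔗 (α : ℝ) (f : ℝ → ℝ) : ℝ → ℝ := fun t => f t + α * 𝔍 f t

/-- `𝔗_A`, the composition of the operators `𝔗_α` over the finite family `A`
(listed in some order; the operators commute, so the order is immaterial). -/
noncomputable def 𝔗l (A : List ℝ) (f : ℝ → ℝ) : ℝ → ℝ := A.foldr 𝔗 f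

theorem continuous_𝔍 {f : ℝ → ℝ} (hf : Continuous f) : Continuous (𝔍 f) :=
  intervalIntegral.continuous_primitive (fun _ _ => hf.intervalIntegrable _ _) 0

theorem continuous_𝔗 (α : ℝ) {f : ℝ → ℝ} (hf : Continuous f) : Continuous (𝔗 α f) :=
  hf.add (continuous_const.mul (continuous_𝔍 hf))

theorem continuous_𝔗l (A : List ℝ) {f : ℝ → ℝ} (hf : Continuous f) : Continuous (𝔗l A f) := by
  induction A with
  | nil => exact hf
  | cons a A ih => exact continuous_𝔗 a ih

theorem 𝔍_congr {f g : ℝ → ℝ} (h : EqOn f g (Ici 0)) : EqOn (𝔍 f) (𝔍 g) (Ici 0) := by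
  intro t ht
  refine intervalIntegral.integral_congr fun s hs => h ?_
  rw [uIcc_of_le (mem_Ici.mp ht)] at hs
  exact hs.1

theorem 𝔗_congr (α : ℝ) {f g : ℝ → ℝ} (h : EqOn f g (Ici 0)) :
    EqOn (𝔗 α f) (𝔗 α g) (Ici 0) := by
  intro t ht
  simp only [𝔗, h ht, 𝔍_congr h ht]

theorem 𝔗l_congr (A : List ℝ) {f g : ℝ → ℝ} (h : EqOn f g (Ici 0)) :
    EqOn (𝔗l A f) (𝔗l A g) (Ici 0) := by
  induction A with
  | nil => exact h
  | cons a A ih => exact 𝔗_congr a ih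

theorem 𝔍_𝔗 (α : ℝ) {f : ℝ → ℝ} (hf : Continuous f) (t : ℝ) :
    𝔍 (𝔗 α f) t = 𝔍 f t + α * 𝔍 (𝔍 f) t := by
  change ∫ s in (0:ℝ)..t, (f s + α * 𝔍 f s) = _
  rw [intervalIntegral.integral_add (hf.intervalIntegrable _ _)
    (((continuous_𝔍 hf).intervalIntegrable _ _).const_mul α), intervalIntegral.integral_const_mul]
  rfl

theorem 𝔗_comm (α β : ℝ) {f : ℝ → ℝ} (hf : Continuous f) :
    𝔗 α (𝔗 β f) = 𝔗 β (𝔗 α f) := by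
  funext t
  change 𝔗 β f t + α * 𝔍 (𝔗 β f) t = 𝔗 α f t + β * 𝔍 (𝔗 α f) t
  rw [𝔍_𝔗 β hf, 𝔍_𝔗 α hf]
  simp only [𝔗]
  ring

theorem 𝔗l_perm {A B : List ℝ} (h : A.Perm B) {f : ℝ → ℝ} (hf : Continuous f) :
    𝔗l A f = 𝔗l B f := by
  induction h with
  | nil => rfl
  | cons a _ ih => exact congrArg (𝔗 a) ih
  | swap a b l => exact 𝔗_comm b a (continuous_𝔗l l hf)
  | trans _ _ ih₁ ih₂ => exact ih₁.trans ih₂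

theorem 𝔗l_𝔗 (A : List ℝ) (a : ℝ) {f : ℝ → ℝ} (hf : Continuous f) :
    𝔗l A (𝔗 a f) = 𝔗l (a :: A) f := by
  rw [← 𝔗l_perm (List.perm_append_singleton a A) hf]
  simp [𝔗l]

theorem 𝔗_neg (α : ℝ) (f : ℝ → ℝ) : 𝔗 α (-f) = -𝔗 α f := by
  funext t
  simp only [𝔗, 𝔍, Pi.neg_apply, intervalIntegral.integral_neg]
  ring

theorem 𝔗l_neg (A : List ℝ) (f : ℝ → ℝ) : 𝔗l A (-f) = -𝔗l A f := by
  induction A with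
  | nil => rfl
  | cons a A ih => exact (congrArg (𝔗 a) ih).trans (𝔗_neg a _)

theorem 𝔗_sum {ι : Type*} (s : Finset ι) (α : ℝ) {f : ι → ℝ → ℝ}
    (hf : ∀ i, Continuous (f i)) :
    𝔗 α (fun t => ∑ i ∈ s, f i t) = fun t => ∑ i ∈ s, 𝔗 α (f i) t := by
  funext t
  simp only [𝔗, 𝔍, Finset.sum_add_distrib, ← Finset.mul_sum]
  rw [intervalIntegral.integral_finsetSum fun i _ => (hf i).intervalIntegrable _ _]

theorem 𝔗l_sum {ι : Type*} (s : Finset ι) (A : List ℝ) {f : ι → ℝ → ℝ}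
    (hf : ∀ i, Continuous (f i)) :
    𝔗l A (fun t => ∑ i ∈ s, f i t) = fun t => ∑ i ∈ s, 𝔗l A (f i) t := by
  induction A with
  | nil => rfl
  | cons a A ih =>
    exact (congrArg (𝔗 a) ih).trans (𝔗_sum s a fun i => continuous_𝔗l A (hf i))

theorem perm_cons_toList_erase {ι : Type*} [DecidableEq ι] {s : Finset ι} {i : ι}
    (hi : i ∈ s) : (i :: (s.erase i).toList).Perm s.toList := by
  have h := Finset.toList_cons (Finset.notMem_erase i s)
  rwa [Finset.cons_eq_insert, Finset.insert_erase hi, List.perm_comm] at h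

/-- Theorem 2(iii): in the class-dependent case `μ_ij = μ_i`, the integral
equation takes the form `∑_i 𝔗_{M_i}(w_i − y_i) + 𝔗_M (∑_j z_j) = 0`, where `M_i` is the
family `(μ_{i'})_{i' ≠ i}` and `M = (μ_{i'})_{i' ∈ I}`. -/
theorem integral_formula_class_dependent
    {I J : Type*} [Fintype I] [Fintype J] [DecidableEq I] [Nonempty I] [Nonempty J]
    (μ : I → ℝ) (hμ : ∀ i, 0 < μ i)
    (y w : I → ℝ → ℝ) (z : J → ℝ → ℝ) (ψ : I → J → ℝ → ℝ)
    (hy : ∀ i, Continuous (y i)) (hw : ∀ i, Continuous (w i))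
    (hz : ∀ j, Continuous (z j)) (hψ : ∀ i j, Continuous (ψ i j))
    (heq1 : ∀ i, ∀ t : ℝ, 0 ≤ t →
      𝔗 (μ i) (fun s => ∑ j, ψ i j s) t = w i t - y i t)
    (heq2 : ∀ j, ∀ t : ℝ, 0 ≤ t → ∑ i, ψ i j t = - z j t) :
    ∀ t : ℝ, 0 ≤ t →
      (∑ i, 𝔗l (((Finset.univ.erase i).toList).map μ) (fun s => w i s - y i s) t)
        + 𝔗l (Finset.univ.toList.map μ) (fun s => ∑ j, z j s) t = 0 := by
  intro t ht
  have hΨ : ∀ i, Continuous fun s => ∑ j, ψ i j s :=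
    fun i => continuous_finsetSum _ fun j _ => hψ i j
  have hterm : ∀ i, 𝔗l (((Finset.univ.erase i).toList).map μ) (fun s => w i s - y i s) t
      = 𝔗l (Finset.univ.toList.map μ) (fun s => ∑ j, ψ i j s) t := by
    intro i
    rw [← 𝔗l_congr _ (fun s hs => heq1 i s hs) ht, 𝔗l_𝔗 _ _ (hΨ i), ← List.map_cons,
      𝔗l_perm ((perm_cons_toList_erase (Finset.mem_univ i)).map μ) (hΨ i)]
  have hz' : EqOn (fun s => ∑ i, ∑ j, ψ i j s) (-fun s => ∑ j, z j s) (Ici 0) := by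
    intro s hs
    simp only [Pi.neg_apply]
    rw [Finset.sum_comm, ← Finset.sum_neg_distrib]
    exact Finset.sum_congr rfl fun j _ => heq2 j s hs
  have hsum := 𝔗l_congr (Finset.univ.toList.map μ) hz' ht
  rw [𝔗l_sum _ _ hΨ, 𝔗l_neg] at hsum
  rw [Finset.sum_congr rfl fun i _ => hterm i]
  beta_reduce at hsum
  rw [hsum, Pi.neg_apply, neg_add_cancel]
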